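/- arXiv:2006.11499 — 5 statements merged into one kernel-verified Lean document; each statement's English description precedes it below -/
import Mathlib

section
/- Let p be a prime with p ≡ 5 (mod 6). Then in 𝔽_p[X], the coefficients of X^{p−1}, X^{2p−1}, X^{p−2}, and X^{2p−2} in the polynomial (X⁶ − 1)^{(p−1)/2} are all zero. (By Nygaard's criterion this says that the genus-2 curve y² = (x³+1)(x³−1) = x⁶ − 1 is superspecial in every characteristic p ≡ 5 (mod 6).) -/
/-- Every exponent occurring in a power of `X ^ n - 1` is a multiple of `n`. -/
theorem Polynomial.coeff_X_pow_sub_one_pow_of_not_dvd {R : Type*} [CommRing R] {n : ℕ}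
    (hn : 0 < n) (m : ℕ) {k : ℕ} (hk : ¬ n ∣ k) :
    ((Polynomial.X ^ n - 1 : Polynomial R) ^ m).coeff k = 0 := by
  have key : (Polynomial.X ^ n - 1 : Polynomial R) ^ m =
      Polynomial.expand R n ((Polynomial.X - 1) ^ m) := by
    simp
  rw [key, Polynomial.coeff_expand hn, if_neg hk]

/-- For a prime `p ≡ 5 (mod 6)`, the coefficients of `X^(p-1)`, `X^(2p-1)`, `X^(p-2)`,
`X^(2p-2)` in `(X⁶ - 1)^((p-1)/2) ∈ 𝔽_p[X]` are all zero. -/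
theorem superspecial_x_six_sub_one
    (p : ℕ) (hp : p.Prime) (h : p % 6 = 5) :
    (((Polynomial.X ^ 6 - 1 : Polynomial (ZMod p)) ^ ((p - 1) / 2)).coeff (p - 1) = 0) ∧
    (((Polynomial.X ^ 6 - 1 : Polynomial (ZMod p)) ^ ((p - 1) / 2)).coeff (2 * p - 1) = 0) ∧
    (((Polynomial.X ^ 6 - 1 : Polynomial (ZMod p)) ^ ((p - 1) / 2)).coeff (p - 2) = 0) ∧
    (((Polynomial.X ^ 6 - 1 : Polynomial (ZMod p)) ^ ((p - 1) / 2)).coeff (2 * p - 2) = 0) := by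
  refine ⟨?_, ?_, ?_, ?_⟩ <;>
    exact Polynomial.coeff_X_pow_sub_one_pow_of_not_dvd (by norm_num) _ (by lia)
end

section
/- Let p be a prime with p ≡ 5 (mod 6), and work in 𝔽_p[X]. Set f₁ = X³ + 1 and f₂ = X³ − 1. Then: (i) f₁ and f₂ are squarefree and coprime; (ii) the coefficient of X^{p−1} in f₁^{(p−1)/2} and the coefficient of X^{p−1} in f₂^{(p−1)/2} are both zero; (iii) the coefficients of X^{p−1}, X^{2p−1}, X^{p−2}, X^{2p−2} in (f₁ f₂)^{(p−1)/2} are all zero. (Via Deuring's and Nygaard's criteria and the decomposition of the Jacobian of a Howe curve, this certifies the part of Theorem 1.1 asserting that for every prime p ≡ 5 (mod 6) there exists a superspecial Howe curve in characteristic p, namely the one built from E₁ : z² = f₁(x) and E₂ : w² = f₂(x).) -/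
open Polynomial in
theorem Polynomial.coeff_X_pow_add_C_pow_of_not_dvd {R : Type*} [CommSemiring R]
    {n k : ℕ} (hn : 0 < n) (hk : ¬ n ∣ k) (c : R) (m : ℕ) :
    ((X ^ n + C c) ^ m).coeff k = 0 := by
  have hexp : (X ^ n + C c) ^ m = expand R n ((X + C c) ^ m) := by simp
  rw [hexp, coeff_expand hn, if_neg hk]

open Polynomial in
/-- For a prime `p ≡ 5 (mod 6)`, with `f₁ = X³ + 1` and `f₂ = X³ - 1` in `𝔽_p[X]`:
(i) `f₁`, `f₂` are squarefree and coprime; (ii) the coefficient of `X^(p-1)` in each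
`fᵢ^((p-1)/2)` is zero; (iii) the coefficients of `X^(p-1)`, `X^(2p-1)`, `X^(p-2)`,
`X^(2p-2)` in `(f₁f₂)^((p-1)/2)` are all zero. -/
theorem superspecial_howe_witness_neg_one
    (p : ℕ) (hp : p.Prime) (h : p % 6 = 5)
    (f₁ f₂ : Polynomial (ZMod p))
    (hf₁ : f₁ = X ^ 3 + 1) (hf₂ : f₂ = X ^ 3 - 1) :
    (Squarefree f₁ ∧ Squarefree f₂ ∧ IsCoprime f₁ f₂) ∧
    ((f₁ ^ ((p - 1) / 2)).coeff (p - 1) = 0 ∧ (f₂ ^ ((p - 1) / 2)).coeff (p - 1) = 0) ∧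
    (((f₁ * f₂) ^ ((p - 1) / 2)).coeff (p - 1) = 0 ∧
     ((f₁ * f₂) ^ ((p - 1) / 2)).coeff (2 * p - 1) = 0 ∧
     ((f₁ * f₂) ^ ((p - 1) / 2)).coeff (p - 2) = 0 ∧
     ((f₁ * f₂) ^ ((p - 1) / 2)).coeff (2 * p - 2) = 0) := by
  have : Fact p.Prime := ⟨hp⟩
  have h₁ : f₁ = X ^ 3 + C 1 := by simp [hf₁]
  have h₂ : f₂ = X ^ 3 + C (-1) := by simp [hf₂, sub_eq_add_neg]
  have h₁₂ : f₁ * f₂ = X ^ 6 + C (-1) := by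
    rw [hf₁, hf₂, map_neg, map_one]
    ring
  have h6 : ((6 : ℕ) : ZMod p) ≠ 0 := by
    rw [Ne, ZMod.natCast_eq_zero_iff]
    intro hdvd
    have := Nat.le_of_dvd (by norm_num) hdvd
    interval_cases p <;> omega
  have hsep : (f₁ * f₂).Separable := by
    rw [h₁₂, map_neg, ← sub_eq_add_neg]
    exact separable_X_pow_sub_C 1 h6 one_ne_zero
  refine ⟨⟨hsep.of_mul_left.squarefree, hsep.of_mul_right.squarefree, hsep.isCoprime⟩, ?_, ?_⟩
  · rw [h₁, h₂]
    constructor <;> exact coeff_X_pow_add_C_pow_of_not_dvd (by norm_num) (by omega) _ _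
  · rw [h₁₂]
    refine ⟨?_, ?_, ?_, ?_⟩ <;>
      exact coeff_X_pow_add_C_pow_of_not_dvd (by norm_num) (by omega) _ _
end

section
/- Let p be a prime with p ≡ 5 (mod 6), and work in 𝔽_p[X]. Set f₁ = X³ + 1 and f₂ = X³ + 4⁻¹ (where 4⁻¹ is the inverse of 4 in 𝔽_p). Then: (i) f₁ and f₂ are squarefree and coprime; (ii) the coefficient of X^{p−1} in f₁^{(p−1)/2} and the coefficient of X^{p−1} in f₂^{(p−1)/2} are both zero; (iii) the coefficients of X^{p−1}, X^{2p−1}, X^{p−2}, X^{2p−2} in (f₁ f₂)^{(p−1)/2} are all zero. (Via Deuring's and Nygaard's criteria, this certifies that the Howe curve built from E₁ : z² = x³ + 1 and E₂ : w² = x³ + 1/4 is superspecial for every prime p ≡ 5 (mod 6), giving a second witness for Theorem 1.1.) -/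
namespace Polynomial

variable {R : Type*} [CommRing R]

theorem derivative_pow_char (p : ℕ) [CharP R p] (S : R[X]) : derivative (S ^ p) = 0 := by
  simp [derivative_pow]

theorem iterate_derivative_mul_of_derivative_eq_zero {M : R[X]} (hM : derivative M = 0)
    (H : R[X]) (k : ℕ) : derivative^[k] (M * H) = M * derivative^[k] H := by
  induction k with
  | zero => rfl
  | succ k ih => simp [Function.iterate_succ_apply', ih, hM]

theorem iterate_derivative_char (p : ℕ) [CharP R p] (hp : p.Prime) (Q : R[X]) :
    derivative^[p] Q = 0 := by
  ext m
  have hdvd : p ∣ (m + p).descFactorial p :=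
    (Nat.dvd_factorial hp.pos le_rfl).trans (Nat.factorial_dvd_descFactorial _ _)
  simp [coeff_iterate_derivative, (CharP.cast_eq_zero_iff R p _).2 hdvd]

/-- A polynomial killed by the `(p-1)`-st derivative in characteristic `p` has no terms of
exponent congruent to `-1` modulo `p`. -/
theorem coeff_eq_zero_of_iterate_derivative_eq_zero [IsDomain R] (p : ℕ) [CharP R p]
    (hp : p.Prime) {H : R[X]} (hH : derivative^[p - 1] H = 0) (j : ℕ) :
    H.coeff (j * p + (p - 1)) = 0 := by
  have h := congrArg (fun P : R[X] => P.coeff (j * p)) hH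
  simp only [coeff_iterate_derivative, coeff_zero, nsmul_eq_mul, mul_eq_zero] at h
  refine h.resolve_left fun h0 => ?_
  rw [CharP.cast_eq_zero_iff R p, Nat.descFactorial_eq_prod_range,
    hp.prime.dvd_finsetProd_iff] at h0
  obtain ⟨i, hi, hdvd⟩ := h0
  rw [Finset.mem_range] at hi
  rw [Nat.add_sub_assoc hi.le, Nat.dvd_add_right (Dvd.intro_left j rfl)] at hdvd
  have := Nat.le_of_dvd (by omega) hdvd
  omega

/-- The pullback of an exact monomial differential `u ^ (e - 1) du` along `u = N / D ^ 2` is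
exact after clearing denominators by a `p`-th power. -/
theorem iterate_derivative_pow_mul_pow_mul [IsDomain R] (p : ℕ) [CharP R p] (hp : p.Prime)
    (N D : R[X]) {a b : ℕ} (ha : ¬ p ∣ a + 1) (hab : p ∣ b + 1 + 2 * (a + 1)) :
    derivative^[p - 1] (N ^ a * D ^ b * (derivative N * D - 2 * N * derivative D)) = 0 := by
  have ha' : ((a + 1 : ℕ) : R[X]) ≠ 0 := by rwa [Ne, CharP.cast_eq_zero_iff R[X] p]
  have hb : ((b + 1 : ℕ) : R[X]) = -2 * ((a + 1 : ℕ) : R[X]) := by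
    have := (CharP.cast_eq_zero_iff R[X] p _).2 hab
    push_cast at this ⊢
    linear_combination this
  have hd : ((a + 1 : ℕ) : R[X]) *
      (N ^ a * D ^ b * (derivative N * D - 2 * N * derivative D)) =
      derivative (N ^ (a + 1) * D ^ (b + 1)) := by
    rw [derivative_mul, derivative_pow_succ, derivative_pow_succ]
    simp only [← Nat.cast_succ, Nat.succ_eq_add_one, map_natCast]
    rw [hb]
    ring
  have h := iterate_derivative_mul_of_derivative_eq_zero
    (derivative_natCast (R := R) (n := a + 1))
    (N ^ a * D ^ b * (derivative N * D - 2 * N * derivative D)) (p - 1)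
  rw [hd, ← Function.iterate_succ_apply, Nat.succ_eq_add_one, Nat.sub_add_cancel hp.one_le,
    iterate_derivative_char p hp] at h
  exact (mul_eq_zero.1 h.symm).resolve_left ha'

/-- If `(N / D ^ 2, y S / D ^ 3)` maps the curve `y ^ 2 = F` to `Y ^ 2 = X ^ 3 + d`, pulling
`dX / Y` back to `g dx / y`, then in characteristic `p ≡ 5 (mod 6)` the Cartier operator kills
`g dx / y`. -/
theorem iterate_derivative_mul_pow_eq_zero [IsDomain R] (p : ℕ) [CharP R p] (hp : p.Prime)
    (h : p % 6 = 5) {F N D S g : R[X]} (d : R) (hS : S ≠ 0)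
    (hF : F * S ^ 2 = N ^ 3 + C d * D ^ 6)
    (hg : derivative N * D - 2 * N * derivative D = g * S) :
    derivative^[p - 1] (F ^ ((p - 1) / 2) * g) = 0 := by
  obtain ⟨n, hn⟩ : ∃ n, p = 2 * n + 1 := ⟨p / 2, by omega⟩
  have hn' : (p - 1) / 2 = n := by omega
  rw [hn']
  have key : S ^ p * (F ^ n * g) = ∑ i ∈ Finset.range (n + 1),
      C (d ^ (n - i) * n.choose i) * (N ^ (3 * i) * D ^ (6 * (n - i)) *
        (derivative N * D - 2 * N * derivative D)) := by
    calc S ^ p * (F ^ n * g) = (F * S ^ 2) ^ n * (g * S) := by rw [hn]; ring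
      _ = _ := by
        rw [hF, ← hg, add_pow, Finset.sum_mul]
        refine Finset.sum_congr rfl fun i _ => ?_
        simp only [map_mul, map_pow, map_natCast, mul_pow, ← pow_mul]
        ring
  have hzero : S ^ p * derivative^[p - 1] (F ^ n * g) = 0 := by
    rw [← iterate_derivative_mul_of_derivative_eq_zero (derivative_pow_char p S), key,
      iterate_derivative_sum]
    refine Finset.sum_eq_zero fun i hi => ?_
    have hi' : i ≤ n := Nat.lt_succ_iff.1 (Finset.mem_range.1 hi)
    rw [iterate_derivative_C_mul, iterate_derivative_pow_mul_pow_mul p hp, mul_zero]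
    · rintro ⟨c, hc⟩
      have hc2 : c < 2 := by
        by_contra! hc2
        have := Nat.mul_le_mul_left p hc2
        omega
      interval_cases c <;> omega
    · exact ⟨3, by omega⟩
  exact (mul_eq_zero.1 hzero).resolve_left (pow_ne_zero p hS)

theorem iterate_derivative_genus_two_eq_zero [IsDomain R] (p : ℕ) [CharP R p] (hp : p.Prime)
    (h : p % 6 = 5) :
    derivative^[p - 1]
      ((2 * X ^ 6 + 5 * X ^ 3 + 2 : R[X]) ^ ((p - 1) / 2) * (X - 1)) = 0 := by
  have h2 : (2 : R) ≠ 0 := by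
    intro h0
    have := Nat.le_of_dvd two_pos ((CharP.cast_eq_zero_iff R p 2).1 (by exact_mod_cast h0))
    omega
  refine iterate_derivative_mul_pow_eq_zero p hp h (1458 : R)
    (N := 8 * X ^ 6 + 24 * X ^ 5 + 30 * X ^ 4 + 29 * X ^ 3 + 30 * X ^ 2 + 24 * X + 8)
    (D := X * (X + 1))
    (S := 16 * X ^ 6 + 72 * X ^ 5 + 144 * X ^ 4 + 175 * X ^ 3 + 144 * X ^ 2 + 72 * X + 16)
    ?_ ?_ ?_
  · intro h0
    have h1 := congrArg (eval 0) h0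
    simp only [eval_add, eval_mul, eval_pow, eval_X, eval_ofNat, eval_zero] at h1
    refine pow_ne_zero 4 h2 ?_
    linear_combination h1
  · rw [map_ofNat]
    ring
  · simp only [derivative_add, derivative_mul, derivative_X_pow, derivative_X, derivative_ofNat,
      derivative_one, map_natCast]
    push_cast
    ring

theorem coeff_expand_three_pow (G : R[X]) (n : ℕ) {k : ℕ} (hk : ¬ 3 ∣ k) :
    ((expand R 3 G) ^ n).coeff k = 0 := by
  rw [← map_pow, coeff_expand (by norm_num), if_neg hk]

end Polynomial

/-- Elements of `𝔽_p` are cubes when `p ≡ 2 (mod 3)`. -/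
theorem ZMod.exists_pow_three_eq (p : ℕ) [Fact p.Prime] (h : p % 3 = 2) (a : ZMod p) :
    ∃ s : ZMod p, s ^ 3 = a := by
  rcases eq_or_ne a 0 with rfl | ha
  · exact ⟨0, by simp⟩
  refine ⟨a ^ ((2 * p - 1) / 3), ?_⟩
  rw [← pow_mul, show (2 * p - 1) / 3 * 3 = (p - 1) * 2 + 1 by omega, pow_succ, pow_mul,
    ZMod.pow_card_sub_one_eq_one ha, one_pow, one_mul]


open Polynomial in
/-- For a prime `p ≡ 5 (mod 6)`, with `f₁ = X³ + 1` and `f₂ = X³ + 4⁻¹` in `𝔽_p[X]`: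
(i) `f₁`, `f₂` are squarefree and coprime; (ii) the coefficient of `X^(p-1)` in each
`fᵢ^((p-1)/2)` is zero; (iii) the coefficients of `X^(p-1)`, `X^(2p-1)`, `X^(p-2)`,
`X^(2p-2)` in `(f₁f₂)^((p-1)/2)` are all zero. -/
theorem superspecial_howe_witness_quarter
    (p : ℕ) (hp : p.Prime) (h : p % 6 = 5)
    (f₁ f₂ : Polynomial (ZMod p))
    (hf₁ : f₁ = X ^ 3 + 1) (hf₂ : f₂ = X ^ 3 + C ((4 : ZMod p)⁻¹)) :
    (Squarefree f₁ ∧ Squarefree f₂ ∧ IsCoprime f₁ f₂) ∧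
    ((f₁ ^ ((p - 1) / 2)).coeff (p - 1) = 0 ∧ (f₂ ^ ((p - 1) / 2)).coeff (p - 1) = 0) ∧
    (((f₁ * f₂) ^ ((p - 1) / 2)).coeff (p - 1) = 0 ∧
     ((f₁ * f₂) ^ ((p - 1) / 2)).coeff (2 * p - 1) = 0 ∧
     ((f₁ * f₂) ^ ((p - 1) / 2)).coeff (p - 2) = 0 ∧
     ((f₁ * f₂) ^ ((p - 1) / 2)).coeff (2 * p - 2) = 0) := by
  have : Fact p.Prime := ⟨hp⟩
  have hnd : ∀ m : ℕ, 0 < m → m < 5 → (m : ZMod p) ≠ 0 := by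
    intro m hm hm5 h0
    have := Nat.le_of_dvd hm ((CharP.cast_eq_zero_iff (ZMod p) p m).1 h0)
    omega
  have h2 : (2 : ZMod p) ≠ 0 := by exact_mod_cast hnd 2 (by norm_num) (by norm_num)
  have h3 : (3 : ZMod p) ≠ 0 := by exact_mod_cast hnd 3 (by norm_num) (by norm_num)
  have h4 : (4 : ZMod p) ≠ 0 := by exact_mod_cast hnd 4 (by norm_num) (by norm_num)
  have he₁ : f₁ = expand (ZMod p) 3 (X + 1) := by simp [hf₁]
  have he₂ : f₂ = expand (ZMod p) 3 (X + C (4 : ZMod p)⁻¹) := by simp [hf₂]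
  have hsep (a : ZMod p) (ha : a ≠ 0) : Squarefree (X ^ 3 + C a : (ZMod p)[X]) := by
    have := (separable_X_pow_sub_C (-a) (n := 3) (by exact_mod_cast h3)
      (neg_ne_zero.2 ha)).squarefree
    simpa using this
  have hp1 : ¬ 3 ∣ p - 1 := by omega
  have hγ₁ : ((f₁ * f₂) ^ ((p - 1) / 2)).coeff (p - 1) = 0 := by
    rw [he₁, he₂, ← map_mul, coeff_expand_three_pow _ _ hp1]
  have hγ₂ : ((f₁ * f₂) ^ ((p - 1) / 2)).coeff (2 * p - 2) = 0 := by
    rw [he₁, he₂, ← map_mul, coeff_expand_three_pow _ _ (by omega)]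
  obtain ⟨s, hs⟩ := ZMod.exists_pow_three_eq p (by omega) (2 : ZMod p)⁻¹
  have hs0 : s ≠ 0 := by
    rintro rfl
    exact inv_ne_zero h2 (by simpa using hs.symm)
  have hscale : (2 * X ^ 6 + 5 * X ^ 3 + 2 : (ZMod p)[X]) =
      C 8 * (f₁ * f₂).comp (C s * X) := by
    have h6 : s ^ 6 = (4 : ZMod p)⁻¹ := by
      rw [show s ^ 6 = (s ^ 3) ^ 2 by ring, hs, inv_pow]
      norm_num
    have hmul : (f₁ * f₂).comp (C s * X) =
        C (s ^ 6) * X ^ 6 + C (s ^ 3 * (1 + 4⁻¹)) * X ^ 3 + C 4⁻¹ := by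
      simp only [hf₁, hf₂, mul_comp, add_comp, pow_comp, X_comp, C_comp, one_comp, map_mul,
        map_pow, map_add, map_one]
      ring
    have e1 : (8 : ZMod p) * 4⁻¹ = 2 := by field_simp; norm_num
    have e2 : (8 : ZMod p) * (2⁻¹ * (1 + 4⁻¹)) = 5 := by field_simp; norm_num
    rw [hmul, h6, hs, mul_add, mul_add, ← mul_assoc, ← mul_assoc, ← C_mul, ← C_mul,
      e1, e2]
    simp only [map_ofNat]
  have hcoeff (k : ℕ) : ((2 * X ^ 6 + 5 * X ^ 3 + 2 : (ZMod p)[X]) ^ ((p - 1) / 2)).coeff k =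
      8 ^ ((p - 1) / 2) * (((f₁ * f₂) ^ ((p - 1) / 2)).coeff k * s ^ k) := by
    rw [hscale, mul_pow, ← C_pow, ← pow_comp, coeff_C_mul, comp_C_mul_X_coeff]
  have h8 : (8 : ZMod p) ≠ 0 := by
    rw [show (8 : ZMod p) = 2 ^ 3 by norm_num]
    exact pow_ne_zero 3 h2
  have hback (k : ℕ)
      (hk : ((2 * X ^ 6 + 5 * X ^ 3 + 2 : (ZMod p)[X]) ^ ((p - 1) / 2)).coeff k = 0) :
      ((f₁ * f₂) ^ ((p - 1) / 2)).coeff k = 0 := by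
    simpa [hcoeff, h8, hs0] using hk
  have hvanish (j : ℕ) :
      ((2 * X ^ 6 + 5 * X ^ 3 + 2 : (ZMod p)[X]) ^ ((p - 1) / 2)).coeff (j * p + (p - 2)) =
      ((2 * X ^ 6 + 5 * X ^ 3 + 2 : (ZMod p)[X]) ^ ((p - 1) / 2)).coeff (j * p + (p - 1)) := by
    have := coeff_eq_zero_of_iterate_derivative_eq_zero p hp
      (iterate_derivative_genus_two_eq_zero (R := ZMod p) p hp h) j
    rw [show j * p + (p - 1) = j * p + (p - 2) + 1 by omega, mul_sub, mul_one, coeff_sub,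
      coeff_mul_X, sub_eq_zero] at this
    rw [this]
    congr 1
    omega
  refine ⟨⟨?_, ?_, ?_⟩, ⟨?_, ?_⟩, hγ₁, hback _ ?_, hback _ ?_, hγ₂⟩
  · simpa [hf₁] using hsep 1 one_ne_zero
  · simpa [hf₂] using hsep _ (inv_ne_zero h4)
  · refine ⟨C (4 / 3), -C (4 / 3), ?_⟩
    have e : (4 / 3 : ZMod p) * (1 - 4⁻¹) = 1 := by field_simp; norm_num
    calc C (4 / 3) * f₁ + -C (4 / 3) * f₂ = C ((4 / 3 : ZMod p) * (1 - 4⁻¹)) := by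
          rw [hf₁, hf₂, C_mul, C_sub, C_1]; ring
      _ = 1 := by rw [e, C_1]
  · rw [he₁, coeff_expand_three_pow _ _ hp1]
  · rw [he₂, coeff_expand_three_pow _ _ hp1]
  · have := hvanish 1
    rw [show 1 * p + (p - 1) = 2 * p - 1 by omega, show 1 * p + (p - 2) = 2 * p - 2 by omega,
      hcoeff (2 * p - 2), hγ₂] at this
    simpa using this.symm
  · have := hvanish 0
    rw [show 0 * p + (p - 1) = p - 1 by omega, show 0 * p + (p - 2) = p - 2 by omega,
      hcoeff (p - 1), hγ₁] at this
    simpa using this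
end

section
/- Let K be a field of characteristic ≠ 2, and let s, t ∈ K with s² = −3/2 and t² = −3/4. Suppose X, Y, W, Z ∈ K satisfy X³ + Y³ + W³ = 0 and 2YW + Z² = 0. Set x = X, y = Y + W, z = sZ, and w = t(Y − W). Then z²y = x³ + y³ and w²y = x³ + (1/4)·y³. (Thus the curve X³+Y³+W³ = 2YW+Z² = 0 in 𝐏³ maps to the fiber product of the genus-1 covers z²y = x³+y³ and w²y = x³+(1/4)y³; this is the correspondence, stated in the paper's concluding remark, identifying the Howe curve for a = 1/4 with the curve studied in [K19].) -/
/-- Let `K` be a field of characteristic `≠ 2` with `s² = -3/2` and `t² = -3/4`.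
If `X³ + Y³ + W³ = 0` and `2YW + Z² = 0`, then with `x = X`, `y = Y + W`, `z = sZ`,
`w = t(Y - W)` we have `z²y = x³ + y³` and `w²y = x³ + (1/4)y³`. -/
theorem howe_curve_quadric_cubic_correspondence
    (K : Type*) [Field K] (hchar : ringChar K ≠ 2)
    (s t X Y W Z : K) (hs : s ^ 2 = -3 / 2) (ht : t ^ 2 = -3 / 4)
    (h1 : X ^ 3 + Y ^ 3 + W ^ 3 = 0) (h2 : 2 * Y * W + Z ^ 2 = 0) :
    (s * Z) ^ 2 * (Y + W) = X ^ 3 + (Y + W) ^ 3 ∧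
    (t * (Y - W)) ^ 2 * (Y + W) = X ^ 3 + (1 / 4) * (Y + W) ^ 3 := by
  have two_ne : (2 : K) ≠ 0 := Ring.two_ne_zero hchar
  have four_ne : (4 : K) ≠ 0 := by
    rw [show (4 : K) = 2 * 2 by norm_num]
    exact mul_ne_zero two_ne two_ne
  have hs' : s ^ 2 * 2 = -3 := (eq_div_iff two_ne).mp hs
  have ht' : t ^ 2 * 4 = -3 := (eq_div_iff four_ne).mp ht
  have h4 : (4 : K) * (1 / 4) = 1 := mul_one_div_cancel four_ne
  constructor
  · apply mul_left_cancel₀ two_ne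
    linear_combination Z ^ 2 * (Y + W) * hs' - 3 * (Y + W) * h2 - 2 * h1
  · apply mul_left_cancel₀ four_ne
    linear_combination (Y - W) ^ 2 * (Y + W) * ht' - 4 * h1 - (Y + W) ^ 3 * h4
end

section
/- Let K be an algebraically closed field of characteristic ≠ 2. Let f₁ = X³ + a₂X² + a₁X + a₀ and f₂ = X³ + b₂X² + b₁X + b₀ be squarefree and coprime polynomials in K[X]. In the polynomial ring K[X, Y, Z, W], set F = Z²Y − (X³ + a₂X²Y + a₁XY² + a₀Y³) and G = Z² − W² − ((a₂−b₂)X² + (a₁−b₁)XY + (a₀−b₀)Y²). Then for every (x, y, z, w) ∈ K⁴ with (x, y, z, w) ≠ (0,0,0,0), F(x,y,z,w) = 0, and G(x,y,z,w) = 0, the 2×4 matrix over K whose first row is (∂F/∂X, ∂F/∂Y, ∂F/∂Z, ∂F/∂W) and whose second row is (∂G/∂X, ∂G/∂Y, ∂G/∂Z, ∂G/∂W), with all partial derivatives evaluated at (x, y, z, w), has rank 2. (That is, the projective curve H' = {F = G = 0} ⊂ 𝐏³ is nonsingular; since H' is the intersection of a quadric and a cubic surface, this is the key step in the paper's Lemma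 2.1 that every Howe curve is a canonical curve of genus 4.) -/
/-- At a root of a squarefree monic cubic, the derivative does not vanish. -/
theorem deriv_ne_zero_of_squarefree_cubic {K : Type*} [Field K] {c₂ c₁ c₀ t : K}
    (hsq : Squarefree (Polynomial.X ^ 3 + Polynomial.C c₂ * Polynomial.X ^ 2 +
      Polynomial.C c₁ * Polynomial.X + Polynomial.C c₀))
    (ht : t ^ 3 + c₂ * t ^ 2 + c₁ * t + c₀ = 0) :
    3 * t ^ 2 + 2 * c₂ * t + c₁ ≠ 0 := by
  intro hd
  obtain rfl : c₁ = -(3 * t ^ 2 + 2 * c₂ * t) := by linear_combination hd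
  obtain rfl : c₀ = 2 * t ^ 3 + c₂ * t ^ 2 := by linear_combination ht
  refine Polynomial.not_isUnit_X_sub_C t
    (hsq _ ⟨Polynomial.X + Polynomial.C (c₂ + 2 * t), ?_⟩)
  simp only [map_add, map_mul, map_neg, map_pow, map_ofNat]
  ring

/-- Coprime cubics have no common root. -/
theorem not_common_root_of_isCoprime_cubic {K : Type*} [Field K] {a₂ a₁ a₀ b₂ b₁ b₀ t : K}
    (hcop : IsCoprime
      (Polynomial.X ^ 3 + Polynomial.C a₂ * Polynomial.X ^ 2 +
        Polynomial.C a₁ * Polynomial.X + Polynomial.C a₀)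
      (Polynomial.X ^ 3 + Polynomial.C b₂ * Polynomial.X ^ 2 +
        Polynomial.C b₁ * Polynomial.X + Polynomial.C b₀))
    (ha : t ^ 3 + a₂ * t ^ 2 + a₁ * t + a₀ = 0) :
    t ^ 3 + b₂ * t ^ 2 + b₁ * t + b₀ ≠ 0 := by
  intro hb
  obtain ⟨u, v, h⟩ := hcop
  simpa [ha, hb] using congrArg (Polynomial.eval t) h

/-- A matrix with two rows and a nonzero maximal minor has rank two. -/
theorem Matrix.rank_eq_two_of_minor_ne_zero {K n : Type*} [Field K] [Fintype n]
    {u v : n → K} (i j : n) (h : u i * v j - u j * v i ≠ 0) :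
    (Matrix.of ![u, v]).rank = 2 := by
  have hli : LinearIndependent K ![u, v] := by
    rw [LinearIndependent.pair_iff]
    intro s t hst
    have hi : s * u i + t * v i = 0 := by simpa using congrFun hst i
    have hj : s * u j + t * v j = 0 := by simpa using congrFun hst j
    constructor
    · refine (mul_eq_zero.mp ?_).resolve_right h
      linear_combination v j * hi - v i * hj
    · refine (mul_eq_zero.mp ?_).resolve_right h
      linear_combination u i * hj - u j * hi
  simpa using LinearIndependent.rank_matrix (M := Matrix.of ![u, v]) hli

open MvPolynomial in
/-- Nonsingularity of the quadric-cubic model `H'` of a Howe curve: for `K` algebraically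
closed of characteristic `≠ 2` and `f₁ = X³+a₂X²+a₁X+a₀`, `f₂ = X³+b₂X²+b₁X+b₀`
squarefree and coprime, the 2×4 Jacobian matrix of
`F = Z²Y - (X³ + a₂X²Y + a₁XY² + a₀Y³)` and
`G = Z² - W² - ((a₂-b₂)X² + (a₁-b₁)XY + (a₀-b₀)Y²)`
has rank 2 at every common zero `(x,y,z,w) ≠ (0,0,0,0)`. -/
theorem howe_quadric_cubic_model_nonsingular
    (K : Type*) [Field K] [IsAlgClosed K] (hchar : ringChar K ≠ 2)
    (a₂ a₁ a₀ b₂ b₁ b₀ : K)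
    (hsq₁ : Squarefree (Polynomial.X ^ 3 + Polynomial.C a₂ * Polynomial.X ^ 2 +
      Polynomial.C a₁ * Polynomial.X + Polynomial.C a₀))
    (hsq₂ : Squarefree (Polynomial.X ^ 3 + Polynomial.C b₂ * Polynomial.X ^ 2 +
      Polynomial.C b₁ * Polynomial.X + Polynomial.C b₀))
    (hcop : IsCoprime
      (Polynomial.X ^ 3 + Polynomial.C a₂ * Polynomial.X ^ 2 +
        Polynomial.C a₁ * Polynomial.X + Polynomial.C a₀)
      (Polynomial.X ^ 3 + Polynomial.C b₂ * Polynomial.X ^ 2 +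
        Polynomial.C b₁ * Polynomial.X + Polynomial.C b₀))
    (F G : MvPolynomial (Fin 4) K)
    (hF : F = (X 2) ^ 2 * (X 1) -
      ((X 0) ^ 3 + C a₂ * (X 0) ^ 2 * (X 1) + C a₁ * (X 0) * (X 1) ^ 2 + C a₀ * (X 1) ^ 3))
    (hG : G = (X 2) ^ 2 - (X 3) ^ 2 -
      (C (a₂ - b₂) * (X 0) ^ 2 + C (a₁ - b₁) * (X 0) * (X 1) + C (a₀ - b₀) * (X 1) ^ 2)) :
    ∀ P : Fin 4 → K, P ≠ 0 → eval P F = 0 → eval P G = 0 →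
      (Matrix.of ![![eval P (pderiv 0 F), eval P (pderiv 1 F),
                     eval P (pderiv 2 F), eval P (pderiv 3 F)],
                   ![eval P (pderiv 0 G), eval P (pderiv 1 G),
                     eval P (pderiv 2 G), eval P (pderiv 3 G)]]).rank = 2 := by
  intro P hP hPF hPG
  have h2 : (2 : K) ≠ 0 := Ring.two_ne_zero hchar
  subst hF hG
  obtain ⟨x, hx⟩ : ∃ x, x = P 0 := ⟨_, rfl⟩
  obtain ⟨y, hy⟩ : ∃ y, y = P 1 := ⟨_, rfl⟩
  obtain ⟨z, hz⟩ : ∃ z, z = P 2 := ⟨_, rfl⟩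
  obtain ⟨w, hw⟩ : ∃ w, w = P 3 := ⟨_, rfl⟩
  have hP' : ¬(x = 0 ∧ y = 0 ∧ z = 0 ∧ w = 0) := by
    rintro ⟨h0, h1, h2, h3⟩
    refine hP (funext fun i => ?_)
    fin_cases i <;> simp_all
  simp only [map_sub, map_add, map_mul, map_pow, eval_X, eval_C, ← hx, ← hy, ← hz, ← hw]
    at hPF hPG
  simp [pderiv_X, Derivation.leibniz_pow, ← hx, ← hy, ← hz, ← hw]
  by_cases hy0 : y = 0
  · subst hy0
    have hx0 : x = 0 := by
      refine pow_eq_zero_iff (n := 3) (by norm_num) |>.mp ?_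
      linear_combination -hPF
    subst hx0
    have hz0 : z ≠ 0 := by
      rintro rfl
      refine hP' ⟨rfl, rfl, rfl, pow_eq_zero_iff (n := 2) (by norm_num) |>.mp ?_⟩
      linear_combination -hPG
    refine Matrix.rank_eq_two_of_minor_ne_zero 1 2 ?_
    have : 2 * z ^ 3 ≠ 0 := mul_ne_zero h2 (pow_ne_zero _ hz0)
    convert this using 1
    simp
    ring
  obtain ⟨t, rfl⟩ : ∃ t, x = t * y := ⟨x / y, by field_simp⟩
  have hz2 : z ^ 2 = y ^ 2 * (t ^ 3 + a₂ * t ^ 2 + a₁ * t + a₀) := by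
    refine mul_right_cancel₀ hy0 ?_
    linear_combination hPF
  have hw2 : w ^ 2 = y ^ 2 * (t ^ 3 + b₂ * t ^ 2 + b₁ * t + b₀) := by
    linear_combination hz2 - hPG
  have hroot {s p : K} (hs : s ^ 2 = y ^ 2 * p) : s = 0 ↔ p = 0 := by
    rw [← pow_eq_zero_iff (n := 2) (by norm_num), hs]
    simp [hy0]
  by_cases hz0 : z = 0
  · have hf := (hroot hz2).mp hz0
    have hw0 : w ≠ 0 := (hroot hw2).not.mpr (not_common_root_of_isCoprime_cubic hcop hf)
    refine Matrix.rank_eq_two_of_minor_ne_zero 0 3 ?_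
    have := mul_ne_zero (mul_ne_zero h2 hw0) (mul_ne_zero (pow_ne_zero 2 hy0)
      (deriv_ne_zero_of_squarefree_cubic hsq₁ hf))
    convert this using 1
    simp
    ring
  by_cases hw0 : w = 0
  · have hf := (hroot hw2).mp hw0
    refine Matrix.rank_eq_two_of_minor_ne_zero 0 2 ?_
    have := neg_ne_zero.mpr (mul_ne_zero (mul_ne_zero h2 hz0) (mul_ne_zero (pow_ne_zero 2 hy0)
      (deriv_ne_zero_of_squarefree_cubic hsq₂ hf)))
    convert this using 1
    simp
    ring
  · refine Matrix.rank_eq_two_of_minor_ne_zero 2 3 ?_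
    have := neg_ne_zero.mpr (mul_ne_zero (mul_ne_zero (mul_ne_zero h2 h2) hy0)
      (mul_ne_zero hz0 hw0))
    convert this using 1
    simp
    ring
end
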